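/- Let G = G_1 ⊕ G_2 be a direct sum of two finitely generated residually finite groups, let P ⊆ ν(G) with ⋂_{N∈P} N = {e_G}, set P_i = P ∩ G_i (viewed in ν(G_i)), and assume P_1 ⊕ P_2 ⊆ P, G_1 ∈ P_1 and G_2 ∈ P_2. Then for every g ∈ G: D_{G,P}(g) ≤ min{D_{G_1,P_1}(π_1(g)), D_{G_2,P_2}(π_2(g))}, where π_i : G → G_i are the natural projections; moreover RF_{G,P,B_G} ≈ max{RF_{G_1,P_1,B_1}, RF_{G_2,P_2,B_2}}. -/

import Mathlib

/-- The word ball of radius `r` in a group `G` with respect to a finite (generating)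
set `S`: products of at most `r` elements of `S ∪ S⁻¹`. -/
def wordBall {G : Type*} [Group G] (S : Finset G) (r : ℝ) : Set G :=
  {g | ∃ l : List G, (∀ x ∈ l, x ∈ S ∨ x⁻¹ ∈ S) ∧ (l.length : ℝ) ≤ r ∧ l.prod = g}

/-- `ν(G)`: the set of finite-index normal subgroups of `G`. -/
def nu (G : Type*) [Group G] : Set (Subgroup G) :=
  {N | N.Normal ∧ N.FiniteIndex}

/-- The divisibility function `D_{G,P}(g) = min {[G:N] : N ∈ P, g ∉ N}`, with value `∞`
when no such `N` exists (in particular at `g = 1`). -/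
noncomputable def divFn {G : Type*} [Group G] (P : Set (Subgroup G)) (g : G) : ℕ∞ :=
  sInf {n : ℕ∞ | ∃ N ∈ P, g ∉ N ∧ n = (N.index : ℕ∞)}

/-- The residual finiteness growth function
`RF_{G,P,B_G}(r) = max {D_{G,P}(g) : 1 ≠ g ∈ B_G(r)}` (as a real-valued function,
taking the value `1` on an empty set of elements). -/
noncomputable def RFgrowth {G : Type*} [Group G] (P : Set (Subgroup G)) (S : Finset G)
    (r : ℝ) : ℝ :=
  sSup (insert 1 ((fun g => ((divFn P g).toNat : ℝ)) '' (wordBall S r \ {1})))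

/-- `f ⪯ g`: there is `C > 0` with `f(r) ≤ C·g(C·r)` for all `r ≥ max {1, 1/C}`. -/
def GrowthLE (f g : ℝ → ℝ) : Prop :=
  ∃ C : ℝ, 0 < C ∧ ∀ r : ℝ, max 1 (1 / C) ≤ r → f r ≤ C * g (C * r)

/-- `f ≈ g`: `f ⪯ g` and `g ⪯ f`. -/
def GrowthEquiv (f g : ℝ → ℝ) : Prop :=
  GrowthLE f g ∧ GrowthLE g f

section WordBall

variable {G H : Type*} [Group G] [Group H]

theorem one_mem_wordBall (S : Finset G) {r : ℝ} (hr : 0 ≤ r) : (1 : G) ∈ wordBall S r :=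
  ⟨[], by simp, by simpa using hr, rfl⟩

theorem wordBall_mono (S : Finset G) {r s : ℝ} (h : r ≤ s) : wordBall S r ⊆ wordBall S s := by
  rintro g ⟨l, hl, hlen, rfl⟩
  exact ⟨l, hl, hlen.trans h, rfl⟩

theorem mul_mem_wordBall {S : Finset G} {r s : ℝ} {g h : G} (hg : g ∈ wordBall S r)
    (hh : h ∈ wordBall S s) : g * h ∈ wordBall S (r + s) := by
  obtain ⟨l, hl, hlen, rfl⟩ := hg
  obtain ⟨m, hm, hmlen, rfl⟩ := hh
  refine ⟨l ++ m, fun x hx => ?_, ?_, List.prod_append⟩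
  · exact (List.mem_append.1 hx).elim (hl x) (hm x)
  · push_cast [List.length_append]
    exact add_le_add hlen hmlen

theorem inv_mem_wordBall {S : Finset G} {r : ℝ} {g : G} (hg : g ∈ wordBall S r) :
    g⁻¹ ∈ wordBall S r := by
  obtain ⟨l, hl, hlen, rfl⟩ := hg
  refine ⟨(l.map (·⁻¹)).reverse, fun x hx => ?_, by simpa using hlen,
    (List.prod_inv_reverse l).symm⟩
  obtain ⟨y, hy, rfl⟩ := List.mem_map.1 (List.mem_reverse.1 hx)
  simpa using (hl y hy).symm

theorem finite_wordBall (S : Finset G) (r : ℝ) : (wordBall S r).Finite := by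
  have hA : {x : G | x ∈ S ∨ x⁻¹ ∈ S}.Finite :=
    S.finite_toSet.union (S.finite_toSet.preimage inv_injective.injOn)
  have : Finite {x : G // x ∈ S ∨ x⁻¹ ∈ S} := hA
  refine ((List.finite_length_le {x : G // x ∈ S ∨ x⁻¹ ∈ S} ⌊r⌋₊).image
    fun l => (l.map Subtype.val).prod).subset ?_
  rintro g ⟨l, hl, hlen, rfl⟩
  lift l to List {x : G // x ∈ S ∨ x⁻¹ ∈ S} using hl
  exact ⟨l, Nat.le_floor (by simpa using hlen), rfl⟩

/-- A homomorphism between finitely generated groups is Lipschitz for the word metrics. -/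
theorem exists_map_mem_wordBall (φ : G →* H) (S : Finset G) {T : Finset H}
    (hT : Subgroup.closure (T : Set H) = ⊤) :
    ∃ K : ℝ, 1 ≤ K ∧ ∀ r : ℝ, ∀ g ∈ wordBall S r, φ g ∈ wordBall T (K * r) := by
  have hw : ∀ h : H, ∃ n : ℕ, h ∈ wordBall T n := fun h => by
    have hh : h ∈ (Subgroup.closure (T : Set H)).toSubmonoid := hT ▸ Subgroup.mem_top h
    rw [Subgroup.closure_toSubmonoid] at hh
    obtain ⟨l, hl, rfl⟩ := Submonoid.exists_list_of_mem_closure hh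
    exact ⟨l.length, l, by simpa using hl, le_rfl, rfl⟩
  choose n hn using hw
  set K : ℕ := 1 + ∑ s ∈ S, n (φ s) with hK
  have hgen : ∀ s ∈ S, φ s ∈ wordBall T K := fun s hs => by
    refine wordBall_mono T (Nat.cast_le.2 ?_) (hn (φ s))
    exact (Finset.single_le_sum (f := fun s => n (φ s)) (fun _ _ => Nat.zero_le _) hs).trans
      (Nat.le_add_left _ _)
  refine ⟨K, Nat.one_le_cast.2 (hK ▸ Nat.le_add_right _ _), ?_⟩
  rintro r g ⟨l, hl, hlen, rfl⟩
  refine wordBall_mono T (mul_le_mul_of_nonneg_left hlen K.cast_nonneg) ?_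
  clear hlen
  induction l with
  | nil => simpa using one_mem_wordBall T le_rfl
  | cons a l ih =>
    have ha : φ a ∈ wordBall T K := (hl a (by simp)).elim (hgen a) fun h => by
      simpa using inv_mem_wordBall (hgen _ h)
    have := mul_mem_wordBall ha (ih fun x hx => hl x (by simp [hx]))
    rw [List.prod_cons, map_mul, List.length_cons]
    rwa [Nat.cast_succ, mul_add, mul_one, add_comm (_ * _)]

end WordBall

section RFgrowth

variable {G H : Type*} [Group G] [Group H]

theorem divFn_le {P : Set (Subgroup G)} {N : Subgroup G} {g : G} (hN : N ∈ P) (hg : g ∉ N) :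
    divFn P g ≤ N.index :=
  sInf_le ⟨N, hN, hg, rfl⟩

theorem divFn_ne_top {P : Set (Subgroup G)} (hP : sInf P = ⊥) {g : G} (hg : g ≠ 1) :
    divFn P g ≠ ⊤ := by
  obtain ⟨N, hN, hgN⟩ : ∃ N ∈ P, g ∉ N := by
    by_contra! h
    exact hg (Subgroup.mem_bot.1 (hP ▸ Subgroup.mem_sInf.2 h))
  exact ((divFn_le hN hgN).trans_lt (ENat.natCast_lt_top _)).ne

theorem sInf_image_comap {P : Set (Subgroup H)} (hP : sInf P = ⊥) {φ : G →* H}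
    (hφ : Function.Injective φ) : sInf (Subgroup.comap φ '' P) = ⊥ := by
  refine (Subgroup.eq_bot_iff_forall _).2 fun g hg => hφ ?_
  rw [map_one, ← Subgroup.mem_bot, ← hP, Subgroup.mem_sInf]
  exact fun N hN => Subgroup.mem_sInf.1 hg _ ⟨N, hN, rfl⟩

theorem divFn_image_comap_le {P : Set (Subgroup H)} (hP : P ⊆ nu H) (φ : G →* H) (g : G) :
    divFn (Subgroup.comap φ '' P) g ≤ divFn P (φ g) := by
  refine le_sInf ?_
  rintro _ ⟨N, hN, hg, rfl⟩
  have := (hP hN).2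
  refine (divFn_le (Set.mem_image_of_mem _ hN) hg).trans (Nat.cast_le.2 ?_)
  rw [Subgroup.index_comap]
  exact Nat.le_of_dvd (Nat.pos_of_ne_zero this.index_ne_zero)
    (have := (hP hN).1; Subgroup.relIndex_dvd_index_of_normal N φ.range)

theorem bddAbove_RFgrowth (P : Set (Subgroup G)) (S : Finset G) (r : ℝ) :
    BddAbove (insert 1 ((fun g => ((divFn P g).toNat : ℝ)) '' (wordBall S r \ {1}))) :=
  (((finite_wordBall S r).sdiff.image _).insert 1).bddAbove

theorem one_le_RFgrowth (P : Set (Subgroup G)) (S : Finset G) (r : ℝ) : 1 ≤ RFgrowth P S r :=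
  le_csSup (bddAbove_RFgrowth P S r) (Set.mem_insert _ _)

theorem divFn_toNat_le_RFgrowth (P : Set (Subgroup G)) {S : Finset G} {r : ℝ} {g : G}
    (hg : g ∈ wordBall S r) (hg1 : g ≠ 1) : ((divFn P g).toNat : ℝ) ≤ RFgrowth P S r :=
  le_csSup (bddAbove_RFgrowth P S r) (Set.mem_insert_of_mem _ ⟨g, ⟨hg, hg1⟩, rfl⟩)

theorem RFgrowth_le {P : Set (Subgroup G)} {S : Finset G} {r B : ℝ} (hB : 1 ≤ B)
    (h : ∀ g ∈ wordBall S r, g ≠ 1 → ((divFn P g).toNat : ℝ) ≤ B) : RFgrowth P S r ≤ B := by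
  refine csSup_le (Set.insert_nonempty _ _) ?_
  rintro _ (rfl | ⟨g, ⟨hg, hg1⟩, rfl⟩)
  exacts [hB, h g hg hg1]

theorem RFgrowth_mono (P : Set (Subgroup G)) (S : Finset G) : Monotone (RFgrowth P S) :=
  fun _ _ h => RFgrowth_le (one_le_RFgrowth P S _) fun _ hg hg1 =>
    divFn_toNat_le_RFgrowth P (wordBall_mono S h hg) hg1

/-- Divisibility bounds transported along a homomorphism bound the growth. -/
theorem divFn_toNat_le_RFgrowth_of_map {P : Set (Subgroup G)} {Q : Set (Subgroup H)}
    (hQ : sInf Q = ⊥) (φ : G →* H) {T : Finset H} {r : ℝ} {g : G}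
    (hφ : φ g ∈ wordBall T r) (hg : φ g ≠ 1) (h : divFn P g ≤ divFn Q (φ g)) :
    ((divFn P g).toNat : ℝ) ≤ RFgrowth Q T r :=
  (Nat.cast_le.2 (ENat.toNat_le_toNat h (divFn_ne_top hQ hg))).trans
    (divFn_toNat_le_RFgrowth Q hφ hg)

theorem RFgrowth_image_comap_le {P : Set (Subgroup H)} (hP : P ⊆ nu H) (hsep : sInf P = ⊥)
    {φ : G →* H} (hφ : Function.Injective φ) {S : Finset G} {T : Finset H} {r s : ℝ}
    (h : ∀ g ∈ wordBall S r, φ g ∈ wordBall T s) :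
    RFgrowth (Subgroup.comap φ '' P) S r ≤ RFgrowth P T s :=
  RFgrowth_le (one_le_RFgrowth P T s) fun g hg hg1 =>
    divFn_toNat_le_RFgrowth_of_map hsep φ (h g hg) ((map_ne_one_iff φ hφ).2 hg1)
      (divFn_image_comap_le hP φ g)

end RFgrowth

theorem growthLE_of_le_comp_mul {f g : ℝ → ℝ} {C : ℝ} (hC : 1 ≤ C) (hg : ∀ r, 0 ≤ g r)
    (h : ∀ r, 1 ≤ r → f r ≤ g (C * r)) : GrowthLE f g :=
  ⟨C, by linarith, fun r hr => (h r ((le_max_left _ _).trans hr)).trans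
    (le_mul_of_one_le_left (hg _) hC)⟩

/-- behaviour of the divisibility function and the residual finiteness
growth with respect to direct products (direct sums) `G = G₁ ⊕ G₂`. Here
`P ∩ Gᵢ` is realised as the image of `P` under `Subgroup.comap` of the canonical
injection `Gᵢ → G₁ × G₂`. -/
theorem stmt_5 {G₁ G₂ : Type*} [Group G₁] [Group G₂]
    (S : Finset (G₁ × G₂)) (hS : Subgroup.closure (S : Set (G₁ × G₂)) = ⊤)
    (S₁ : Finset G₁) (hS₁ : Subgroup.closure (S₁ : Set G₁) = ⊤)
    (S₂ : Finset G₂) (hS₂ : Subgroup.closure (S₂ : Set G₂) = ⊤)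
    (P : Set (Subgroup (G₁ × G₂))) (hP : P ⊆ nu (G₁ × G₂)) (hsep : sInf P = ⊥)
    (P₁ : Set (Subgroup G₁)) (P₂ : Set (Subgroup G₂))
    (hP₁ : P₁ = Subgroup.comap (MonoidHom.inl G₁ G₂) '' P)
    (hP₂ : P₂ = Subgroup.comap (MonoidHom.inr G₁ G₂) '' P)
    (hdsum : ∀ N₁ ∈ P₁, ∀ N₂ ∈ P₂, N₁.prod N₂ ∈ P)
    (htop₁ : (⊤ : Subgroup G₁) ∈ P₁) (htop₂ : (⊤ : Subgroup G₂) ∈ P₂) :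
    (∀ g : G₁ × G₂, divFn P g ≤ min (divFn P₁ g.1) (divFn P₂ g.2)) ∧
    GrowthEquiv (RFgrowth P S)
      (fun r => max (RFgrowth P₁ S₁ r) (RFgrowth P₂ S₂ r)) := by
  have hD : ∀ g : G₁ × G₂, divFn P g ≤ min (divFn P₁ g.1) (divFn P₂ g.2) := by
    refine fun g => le_min (le_sInf ?_) (le_sInf ?_)
    · rintro _ ⟨N, hN, hg, rfl⟩
      simpa [Subgroup.index_prod] using
        divFn_le (hdsum N hN ⊤ htop₂) fun h => hg (Subgroup.mem_prod.1 h).1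
    · rintro _ ⟨N, hN, hg, rfl⟩
      simpa [Subgroup.index_prod] using
        divFn_le (hdsum ⊤ htop₁ N hN) fun h => hg (Subgroup.mem_prod.1 h).2
  have hinl : Function.Injective (MonoidHom.inl G₁ G₂) := fun a b h => (Prod.ext_iff.1 h).1
  have hinr : Function.Injective (MonoidHom.inr G₁ G₂) := fun a b h => (Prod.ext_iff.1 h).2
  have hsep₁ : sInf P₁ = ⊥ := hP₁ ▸ sInf_image_comap hsep hinl
  have hsep₂ : sInf P₂ = ⊥ := hP₂ ▸ sInf_image_comap hsep hinr
  refine ⟨hD, ?_, ?_⟩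
  · obtain ⟨K₁, hK₁, h₁⟩ := exists_map_mem_wordBall (MonoidHom.fst G₁ G₂) S hS₁
    obtain ⟨K₂, hK₂, h₂⟩ := exists_map_mem_wordBall (MonoidHom.snd G₁ G₂) S hS₂
    refine growthLE_of_le_comp_mul (C := max K₁ K₂) (hK₁.trans (le_max_left _ _))
      (fun r => zero_le_one.trans ((one_le_RFgrowth P₁ S₁ r).trans (le_max_left _ _)))
      fun r hr => RFgrowth_le ((one_le_RFgrowth P₁ S₁ _).trans (le_max_left _ _))
        fun g hg hg1 => ?_
    by_cases hg₁ : g.1 = 1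
    · have hg₂ : g.2 ≠ 1 := fun h => hg1 (Prod.ext hg₁ h)
      refine le_max_of_le_right (divFn_toNat_le_RFgrowth_of_map hsep₂ (MonoidHom.snd G₁ G₂)
        (wordBall_mono S₂ ?_ (h₂ r g hg)) hg₂ ((hD g).trans (min_le_right _ _)))
      gcongr
      exact le_max_right _ _
    · refine le_max_of_le_left (divFn_toNat_le_RFgrowth_of_map hsep₁ (MonoidHom.fst G₁ G₂)
        (wordBall_mono S₁ ?_ (h₁ r g hg)) hg₁ ((hD g).trans (min_le_left _ _)))
      gcongr
      exact le_max_left _ _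
  · obtain ⟨K₁, hK₁, h₁⟩ := exists_map_mem_wordBall (MonoidHom.inl G₁ G₂) S₁ hS
    obtain ⟨K₂, hK₂, h₂⟩ := exists_map_mem_wordBall (MonoidHom.inr G₁ G₂) S₂ hS
    refine growthLE_of_le_comp_mul (C := max K₁ K₂) (hK₁.trans (le_max_left _ _))
      (fun r => zero_le_one.trans (one_le_RFgrowth P S r)) fun r hr => max_le ?_ ?_
    · subst hP₁
      refine (RFgrowth_image_comap_le hP hsep hinl (h₁ r)).trans (RFgrowth_mono P S ?_)
      gcongr
      exact le_max_left _ _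
    · subst hP₂
      refine (RFgrowth_image_comap_le hP hsep hinr (h₂ r)).trans (RFgrowth_mono P S ?_)
      gcongr
      exact le_max_right _ _
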